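/- Let n ≥ 4 and let G be a finite simple graph that is Ramsey for K_n. Suppose a 2-colouring of the edges of G contains no monochromatic copy of K_n + K_{n-1}. Then any two distinct vertex sets S and S' that are each a monochromatic K_n in the same colour b satisfy |S ∩ S'| ≥ 3. -/

import Mathlib

open Finset

/-- `S` is a monochromatic `K_m` in colour `b`: it has exactly `m` vertices,
its vertices are pairwise adjacent in `G`, and every edge inside `S` has colour `b`. -/
def IsMonoClique {V : Type*} (G : SimpleGraph V) (c : V → V → Bool) (b : Bool)
    (m : ℕ) (S : Finset V) : Prop :=
  S.card = m ∧ (∀ x ∈ S, ∀ y ∈ S, x ≠ y → G.Adj x y) ∧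
    (∀ x ∈ S, ∀ y ∈ S, x ≠ y → c x y = b)

/-- `G` is Ramsey for `K n`: every symmetric 2-colouring of the edges of `G`
contains a monochromatic `K n` in some colour. -/
def IsRamseyFor {V : Type*} (G : SimpleGraph V) (n : ℕ) : Prop :=
  ∀ c : V → V → Bool, (∀ x y, c x y = c y x) →
    ∃ b S, IsMonoClique G c b n S

/-- `G` is Ramsey for `K n + K m`: every symmetric 2-colouring of the edges of `G`
contains, in some colour `b`, two disjoint vertex sets that are a monochromatic `K n`
and a monochromatic `K m` in colour `b`. -/
def IsRamseyForPair {V : Type*} (G : SimpleGraph V) (n m : ℕ) : Prop :=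
  ∀ c : V → V → Bool, (∀ x y, c x y = c y x) →
    ∃ b S T, Disjoint S T ∧ IsMonoClique G c b n S ∧ IsMonoClique G c b m T

section

lemma IsMonoClique.subset {α : Type*} {G : SimpleGraph α} {c c' : α → α → Bool} {b : Bool} {m k : ℕ}
    {S T : Finset α} (hS : IsMonoClique G c b m S) (hT : T ⊆ S) (hk : T.card = k)
    (hc : ∀ x ∈ T, ∀ y ∈ T, c' x y = c x y) : IsMonoClique G c' b k T :=
  ⟨hk, fun x hx y hy h => hS.2.1 x (hT hx) y (hT hy) h,
    fun x hx y hy h => (hc x hx y hy).trans (hS.2.2 x (hT hx) y (hT hy) h)⟩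

variable {α : Type*} [DecidableEq α]

lemma IsMonoClique.card_inter_le_one {G : SimpleGraph α} {c : α → α → Bool} {b b' : Bool}
    {m k : ℕ} {S T : Finset α} (hS : IsMonoClique G c b m S) (hT : IsMonoClique G c b' k T)
    (hb : b ≠ b') : (S ∩ T).card ≤ 1 := by
  rw [Finset.card_le_one]
  intro x hx y hy
  rw [Finset.mem_inter] at hx hy
  by_contra h
  exact hb ((hS.2.2 x hx.1 y hy.1 h).symm.trans (hT.2.2 x hx.2 y hy.2 h))

/-- Recolour the edges meeting `X`: those inside `X` get colour `!b`, those leaving `X` are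
coloured by `p`. -/
def recolour (c : α → α → Bool) (b : Bool) (X : Finset α) (p : α → α → Bool) (x y : α) : Bool :=
  if x ∈ X then (if y ∈ X then !b else p x y) else if y ∈ X then p y x else c x y

/-- Recolouring the edges meeting `X` as in `recolour` leaves no monochromatic `K n` meeting `X`,
and all the monochromatic `K (n - 1)` in colour `!b` meeting `X` contain the set `X₀`. -/
structure IsGadget (G : SimpleGraph α) (c : α → α → Bool) (n : ℕ) (b : Bool)
    (X X₀ : Finset α) (p : α → α → Bool) : Prop where
  no_extension : ∀ x ∈ X, ∀ K, Disjoint K X → IsMonoClique G c b (n - 1) K →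
    ∃ z ∈ K, p x z ≠ b
  no_clique : ∀ C, (C ∩ X).Nonempty → ¬ IsMonoClique G (recolour c b X p) (!b) n C
  core_subset : ∀ C, (C ∩ X).Nonempty → IsMonoClique G (recolour c b X p) (!b) (n - 1) C →
    X₀ ⊆ C ∩ X

lemma IsGadget.not_isMonoClique {G : SimpleGraph α} {c c' : α → α → Bool} {n : ℕ} {b b' : Bool}
    {X X₀ Y Y₀ : Finset α} {p q : α → α → Bool} (hb : b' = !b)
    (hX : IsGadget G c n b X X₀ p) (hY : IsGadget G c n b' Y Y₀ q)
    (hYY : ∀ y ∈ Y, ∀ z ∈ Y, c' y z = b)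
    (hoff : ∀ y ∉ Y, ∀ z ∉ Y, c' y z = recolour c b X p y z)
    (hout : ∀ y ∈ Y, ∀ z ∉ X, z ∉ Y → c' y z = q y z)
    (hXY : ∀ y ∈ Y, ∃ x ∈ X₀, x ∈ X → c' x y = b)
    (hno : ∀ K, Disjoint K X → Disjoint K Y → ¬ IsMonoClique G c b' n K) (K : Finset α) :
    ¬ IsMonoClique G c' b' n K := by
  subst hb
  intro hK
  by_cases hKY : Disjoint K Y
  · have hYn : ∀ x ∈ K, x ∉ Y := fun x hx => Finset.disjoint_left.1 hKY hx
    by_cases hKX : Disjoint K X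
    · have hXn : ∀ x ∈ K, x ∉ X := fun x hx => Finset.disjoint_left.1 hKX hx
      refine hno K hKX hKY (hK.subset subset_rfl hK.1 fun x hx y hy => ?_)
      rw [hoff x (hYn x hx) y (hYn y hy)]
      simp [recolour, hXn x hx, hXn y hy]
    · rw [Finset.disjoint_iff_inter_eq_empty, ← Ne, ← Finset.nonempty_iff_ne_empty] at hKX
      exact hX.no_clique K hKX (hK.subset subset_rfl hK.1 fun x hx y hy =>
        (hoff x (hYn x hx) y (hYn y hy)).symm)
  · obtain ⟨y, hyK, hyY⟩ := Finset.not_disjoint_iff.1 hKY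
    have hYn : ∀ x ∈ K.erase y, x ∉ Y := by
      intro x hx hxY
      have h := hK.2.2 x (Finset.mem_of_mem_erase hx) y hyK (Finset.ne_of_mem_erase hx)
      rw [hYY x hxY y hyY] at h
      simp at h
    have hcard : (K.erase y).card = n - 1 := by rw [Finset.card_erase_of_mem hyK, hK.1]
    by_cases hKX : Disjoint (K.erase y) X
    · have hXn : ∀ x ∈ K.erase y, x ∉ X := fun x hx => Finset.disjoint_left.1 hKX hx
      obtain ⟨z, hz, hqz⟩ := hY.no_extension y hyY (K.erase y)
        (Finset.disjoint_left.2 hYn)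
        (hK.subset (Finset.erase_subset _ _) hcard fun x hx z hz => by
          rw [hoff x (hYn x hx) z (hYn z hz)]
          simp [recolour, hXn x hx, hXn z hz])
      apply hqz
      rw [← hout y hyY z (hXn z hz) (hYn z hz)]
      exact hK.2.2 y hyK z (Finset.mem_of_mem_erase hz) (Finset.ne_of_mem_erase hz).symm
    · rw [Finset.disjoint_iff_inter_eq_empty, ← Ne, ← Finset.nonempty_iff_ne_empty] at hKX
      have hsub := hX.core_subset _ hKX (hK.subset (Finset.erase_subset _ _) hcard
        fun x hx z hz => (hoff x (hYn x hx) z (hYn z hz)).symm)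
      obtain ⟨x, hx, hxy⟩ := hXY y hyY
      have hx' := Finset.mem_inter.1 (hsub hx)
      have h := hK.2.2 x (Finset.mem_of_mem_erase hx'.1) y hyK (Finset.ne_of_mem_erase hx'.1)
      rw [hxy hx'.2] at h
      simp at h

lemma IsGadget.not_isRamseyFor {G : SimpleGraph α} {c : α → α → Bool} (hc : ∀ x y, c x y = c y x)
    {n : ℕ} {b : Bool} {X X₀ Y Y₀ : Finset α} {p q : α → α → Bool}
    (hX : IsGadget G c n b X X₀ p) (hY : IsGadget G c n (!b) Y Y₀ q) (hdisj : Disjoint X Y)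
    (hX₀ : 2 ≤ X₀.card) (hY₀ : 2 ≤ Y₀.card)
    (hno : ∀ d K, Disjoint K X → Disjoint K Y → ¬ IsMonoClique G c d n K) :
    ¬ IsRamseyFor G n := by
  intro hG
  obtain ⟨x₁, hx₁, x₂, hx₂, hx⟩ := Finset.one_lt_card.1 hX₀
  obtain ⟨y₁, hy₁, y₂, hy₂, hy⟩ := Finset.one_lt_card.1 hY₀
  have hXY : ∀ z ∈ X, z ∉ Y := fun z hz => Finset.disjoint_left.1 hdisj hz
  have hYX : ∀ z ∈ Y, z ∉ X := fun z hz => Finset.disjoint_right.1 hdisj hz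
  let f : α → α → Bool := fun x y => if (x = x₁ ↔ y = y₁) then !b else b
  let c' : α → α → Bool := fun z w =>
    if z ∈ X then if w ∈ Y then f z w else recolour c b X p z w
    else if z ∈ Y then if w ∈ X then f w z else recolour c (!b) Y q z w
    else if w ∈ Y then recolour c (!b) Y q z w else recolour c b X p z w
  have hc' : ∀ z w, c' z w = c' w z := by
    intro z w
    have := hXY z
    have := hXY w
    have := hc z w
    simp only [c', recolour]
    split_ifs <;> simp_all
  obtain ⟨d, K, hK⟩ := hG c' hc'
  by_cases hd : d = !b
  · refine hX.not_isMonoClique (c' := c') hd (hd ▸ hY) ?_ ?_ ?_ ?_ (hno d) K hK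
    · intro y hy z hz
      simp [c', recolour, hYX y hy, hYX z hz, hy, hz]
    · intro y hy z hz
      simp only [c', recolour]
      split_ifs <;> simp_all
    · intro y hy z hz hz'
      simp [c', recolour, hYX y hy, hy, hz, hz']
    · intro y hyY
      by_cases h : y = y₁
      · exact ⟨x₂, hx₂, fun hxX => by
          simp [c', hxX, (h ▸ hyY : y₁ ∈ Y), f, h, hx.symm]⟩
      · exact ⟨x₁, hx₁, fun hxX => by simp [c', hxX, hyY, f, h]⟩
  · have hd : d = b := by cases d <;> cases b <;> simp_all
    subst hd
    refine hY.not_isMonoClique (c' := c') (by simp) hX ?_ ?_ ?_ ?_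
      (fun K h h' => hno d K h' h) K hK
    · intro y hy z hz
      simp [c', recolour, hXY z hz, hy, hz]
    · intro y hy z hz
      simp only [c', recolour]
      split_ifs <;> simp_all
    · intro y hy z hz hz'
      simp [c', recolour, hy, hz, hz']
    · intro x hxX
      by_cases h : x = x₁
      · exact ⟨y₁, hy₁, fun hyY => by
          simp [c', f, hYX y₁ hyY, (h ▸ hxX : x₁ ∈ X), hyY, h]⟩
      · exact ⟨y₂, hy₂, fun hyY => by
          simp [c', f, hxX, hYX y₂ hyY, hyY, h, hy.symm]⟩

lemma isGadget_empty (G : SimpleGraph α) (c : α → α → Bool) (n : ℕ) (b : Bool) (X₀ : Finset α)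
    (p : α → α → Bool) : IsGadget G c n b ∅ X₀ p :=
  ⟨by simp, by simp, by simp⟩

lemma isGadget_of_isMonoClique {G : SimpleGraph α} {c : α → α → Bool} {n : ℕ} {b : Bool}
    {S : Finset α} (hS : IsMonoClique G c b n S)
    (hdisj : ∀ T, IsMonoClique G c b (n - 1) T → ¬ Disjoint S T)
    {r s : α} (hr : r ∈ S) (hs : s ∈ S) (hrs : r ≠ s) :
    IsGadget G c n b ((S.erase r).erase s) ((S.erase r).erase s)
      (fun _ z => if z ∈ S then !b else b) := by
  have key : ∀ m C, (C ∩ (S.erase r).erase s).Nonempty →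
      IsMonoClique G (recolour c b ((S.erase r).erase s) fun _ z => if z ∈ S then !b else b)
        (!b) m C → C ⊆ S ∧ (r ∉ C ∨ s ∉ C) := by
    rintro m C ⟨x, hx⟩ hC
    obtain ⟨hxC, hxX⟩ := Finset.mem_inter.1 hx
    constructor
    · intro z hz
      by_contra hzS
      have h := hC.2.2 x hxC z hz (by rintro rfl; simp_all)
      simp [recolour, hxX, hzS] at h
    · by_contra! h
      have h1 := hC.2.2 r h.1 s h.2 hrs
      have h2 := hS.2.2 r hr s hs hrs
      simp [recolour, h2] at h1
  refine ⟨?_, ?_, ?_⟩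
  · intro x _ K _ hK
    obtain ⟨z, hzS, hzK⟩ := Finset.not_disjoint_iff.1 (hdisj K hK)
    exact ⟨z, hzK, by simp [hzS]⟩
  · intro C hne hC
    obtain ⟨hsub, h⟩ := key n C hne hC
    have := Finset.eq_of_subset_of_card_le hsub (by rw [hC.1, hS.1])
    simp_all
  · intro C hne hC
    obtain ⟨hsub, h⟩ := key _ C hne hC
    refine Finset.subset_inter ?_ subset_rfl
    have hle : ∀ t ∈ S, t ∉ C → S.erase t ⊆ C := by
      intro t ht htC
      refine (Finset.eq_of_subset_of_card_le (fun z hz => Finset.mem_erase.2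
        ⟨by rintro rfl; exact htC hz, hsub hz⟩) ?_).ge
      rw [Finset.card_erase_of_mem ht, hC.1, hS.1]
    intro z hz
    rw [Finset.mem_erase, Finset.mem_erase] at hz
    rcases h with h | h
    · exact hle r hr h (Finset.mem_erase.2 ⟨hz.2.1, hz.2.2⟩)
    · exact hle s hs h (Finset.mem_erase.2 ⟨hz.1, hz.2.2⟩)

lemma isGadget_of_two_isMonoClique {G : SimpleGraph α} {c : α → α → Bool} {n : ℕ} (hn : 4 ≤ n)
    {b : Bool} {S S' : Finset α} (hS : IsMonoClique G c b n S) (hS' : IsMonoClique G c b n S')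
    (hdisj : ∀ S T, IsMonoClique G c b n S → IsMonoClique G c b (n - 1) T → ¬ Disjoint S T)
    {a v : α} (ha : a ∈ S) (ha' : a ∉ S') (hv : v ∈ S) (hv' : v ∈ S') :
    IsGadget G c n b (S.erase a) ((S.erase a).erase v)
      (fun x z => if z ∈ (if x = v then S' else S) then !b else b) := by
  have hva : v ≠ a := by rintro rfl; exact ha' hv'
  set p : α → α → Bool := fun x z => if z ∈ (if x = v then S' else S) then !b else b
  have key : ∀ m C, n - 1 ≤ m → (C ∩ S.erase a).Nonempty →
      IsMonoClique G (recolour c b (S.erase a) p) (!b) m C → C ⊆ S ∧ (a ∉ C ∨ v ∉ C) := by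
    rintro m C hm hne hC
    have hav : a ∉ C ∨ v ∉ C := by
      by_contra! h
      have := hC.2.2 v h.2 a h.1 hva
      simp [recolour, hva, hv, p, ha'] at this
    refine ⟨?_, hav⟩
    by_cases hx : ∃ x ∈ C ∩ S.erase a, x ≠ v
    · obtain ⟨x, hx, hxv⟩ := hx
      obtain ⟨hxC, hxX⟩ := Finset.mem_inter.1 hx
      intro z hz
      by_contra hzS
      have h := hC.2.2 x hxC z hz (by rintro rfl; simp_all)
      have hzX : z ∉ S.erase a := fun h => hzS (Finset.mem_of_mem_erase h)
      simp only [recolour, if_pos hxX, if_neg hzX, p, if_neg hxv, if_neg hzS] at h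
      simp at h
    · push Not at hx
      exfalso
      obtain ⟨x, hxCX⟩ := hne
      obtain rfl := hx x hxCX
      obtain ⟨hxC, hxX⟩ := Finset.mem_inter.1 hxCX
      have hout : ∀ z ∈ C.erase x, z ∉ S.erase a := fun z hz hzX =>
        Finset.ne_of_mem_erase hz (hx z (Finset.mem_inter.2 ⟨Finset.mem_of_mem_erase hz, hzX⟩))
      have hsub : C.erase x ⊆ S' := by
        intro z hz
        by_contra hzS
        have h := hC.2.2 x hxC z (Finset.mem_of_mem_erase hz) (Finset.ne_of_mem_erase hz).symm
        simp only [recolour, if_pos hxX, if_neg (hout z hz), p, if_true, if_neg hzS] at h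
        simp at h
      have hmono : IsMonoClique G c (!b) (C.erase x).card (C.erase x) :=
        hC.subset (Finset.erase_subset _ _) rfl fun y hy z hz => by
          simp only [recolour, if_neg (hout y hy), if_neg (hout z hz)]
      have h1 := hmono.card_inter_le_one hS' (by simp)
      rw [Finset.inter_eq_left.2 hsub, Finset.card_erase_of_mem hxC, hC.1] at h1
      omega
  refine ⟨?_, ?_, ?_⟩
  · intro x _ K _ hK
    by_cases hxv : x = v
    · obtain ⟨z, hzS, hzK⟩ := Finset.not_disjoint_iff.1 (hdisj S' K hS' hK)
      exact ⟨z, hzK, by simp [p, hxv, hzS]⟩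
    · obtain ⟨z, hzS, hzK⟩ := Finset.not_disjoint_iff.1 (hdisj S K hS hK)
      exact ⟨z, hzK, by simp [p, hxv, hzS]⟩
  · intro C hne hC
    obtain ⟨hsub, h⟩ := key n C (by omega) hne hC
    have := Finset.eq_of_subset_of_card_le hsub (by rw [hC.1, hS.1])
    simp_all
  · intro C hne hC
    obtain ⟨hsub, h⟩ := key _ C le_rfl hne hC
    refine Finset.subset_inter ?_ (Finset.erase_subset _ _)
    have hle : ∀ t ∈ S, t ∉ C → S.erase t ⊆ C := by
      intro t ht htC
      refine (Finset.eq_of_subset_of_card_le (fun z hz => Finset.mem_erase.2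
        ⟨by rintro rfl; exact htC hz, hsub hz⟩) ?_).ge
      rw [Finset.card_erase_of_mem ht, hC.1, hS.1]
    intro z hz
    rw [Finset.mem_erase, Finset.mem_erase] at hz
    rcases h with h | h
    · exact hle a ha h (Finset.mem_erase.2 ⟨hz.2.1, hz.2.2⟩)
    · exact hle v hv h (Finset.mem_erase.2 ⟨hz.1, hz.2.2⟩)

/-- In a colouring of a Ramsey graph for `K n` without a monochromatic `K n + K (n - 1)`, there is
at most one monochromatic `K n` in each colour. -/
lemma IsMonoClique.eq_of_no_pair {n : ℕ} (hn : 4 ≤ n) {G : SimpleGraph α} (hG : IsRamseyFor G n)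
    {c : α → α → Bool} (hc : ∀ u v, c u v = c v u)
    (hno : ¬ ∃ b S T, Disjoint S T ∧ IsMonoClique G c b n S ∧ IsMonoClique G c b (n - 1) T)
    {S S' : Finset α} {b : Bool} (hS : IsMonoClique G c b n S)
    (hS' : IsMonoClique G c b n S') : S = S' := by
  by_contra hne
  have hdisj : ∀ d S T, IsMonoClique G c d n S → IsMonoClique G c d (n - 1) T →
      ¬ Disjoint S T := fun d S T hS hT h => hno ⟨d, S, T, h, hS, hT⟩
  have hmeet : ∀ d S T, IsMonoClique G c d n S → IsMonoClique G c d n T → ∀ x ∈ S,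
      ¬ Disjoint (S.erase x) T := fun d S T hS hT x hx h =>
    hdisj d T (S.erase x) hT (hS.subset (Finset.erase_subset _ _)
      (by rw [Finset.card_erase_of_mem hx, hS.1]) fun _ _ _ _ => rfl) h.symm
  have hpair : ∀ d S S', IsMonoClique G c d n S → IsMonoClique G c d n S' → S ≠ S' →
      ∃ a ∈ S, a ∉ S' ∧ ∃ v ∈ S, v ∈ S' := by
    intro d S S' hS hS' hne
    obtain ⟨a, ha, ha'⟩ := Finset.not_subset.1 fun h =>
      hne (Finset.eq_of_subset_of_card_le h (by rw [hS.1, hS'.1]))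
    obtain ⟨v, hv, hv'⟩ := Finset.not_disjoint_iff.1 (hmeet d S S' hS hS' a ha)
    exact ⟨a, ha, ha', v, Finset.mem_of_mem_erase hv, hv'⟩
  have hcard : ∀ d S, IsMonoClique G c d n S → ∀ x ∈ S, ∀ y ∈ S, x ≠ y →
      2 ≤ ((S.erase x).erase y).card := by
    intro d S hS x hx y hy hxy
    rw [Finset.card_erase_of_mem (Finset.mem_erase.2 ⟨hxy.symm, hy⟩),
      Finset.card_erase_of_mem hx, hS.1]
    omega
  obtain ⟨a, ha, ha', v, hv, hv'⟩ := hpair b S S' hS hS' hne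
  have hav : a ≠ v := by rintro rfl; exact ha' hv'
  have hX := isGadget_of_two_isMonoClique hn hS hS' (hdisj b) ha ha' hv hv'
  have hX₀ := hcard b S hS a ha v hv hav
  have hfinal : ∀ Y Y₀ q, IsGadget G c n (!b) Y Y₀ q → Disjoint (S.erase a) Y → 2 ≤ Y₀.card →
      (∀ K, Disjoint K (S.erase a) → Disjoint K Y → ¬ IsMonoClique G c (!b) n K) → False := by
    intro Y Y₀ q hY hXY hY₀ hK
    refine hX.not_isRamseyFor hc hY hXY hX₀ hY₀ (fun d K hKX hKY hKd => ?_) hG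
    by_cases hd : d = !b
    · exact hK K hKX hKY (hd ▸ hKd)
    · have hd : d = b := by cases d <;> cases b <;> simp_all
      subst hd
      exact hmeet d S K hS hKd a ha hKX.symm
  by_cases hU : ∃ U, IsMonoClique G c (!b) n U
  · obtain ⟨U, hU⟩ := hU
    have hSU := hS.card_inter_le_one hU (by simp)
    rw [Finset.card_le_one] at hSU
    have hUcard : 1 < U.card := by rw [hU.1]; omega
    by_cases ht : Disjoint (S.erase a) U
    · by_cases hU' : ∃ U', IsMonoClique G c (!b) n U' ∧ U ≠ U'
      · obtain ⟨U', hU', hne'⟩ := hU'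
        obtain ⟨r, hr, hr', w, hw, hw'⟩ := hpair _ U U' hU hU' hne'
        refine hfinal _ _ _ (isGadget_of_two_isMonoClique hn hU hU' (hdisj _) hr hr' hw hw')
          (ht.mono_right (Finset.erase_subset _ _))
          (hcard _ U hU r hr w hw (by rintro rfl; exact hr' hw')) fun K _ hKY hK => ?_
        exact hmeet _ U K hU hK r hr hKY.symm
      · push Not at hU'
        obtain ⟨r, hr, s, hs, hrs⟩ := Finset.one_lt_card.1 hUcard
        have h2 := hcard _ U hU r hr s hs hrs
        refine hfinal _ _ _ (isGadget_of_isMonoClique hU (fun T => hdisj _ U T hU) hr hs hrs)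
          (ht.mono_right ((Finset.erase_subset _ _).trans (Finset.erase_subset _ _))) h2
          fun K _ hKY hK => ?_
        obtain rfl := hU' K hK
        obtain ⟨z, hz⟩ := Finset.card_pos.1 (by omega : 0 < ((U.erase r).erase s).card)
        exact Finset.disjoint_left.1 hKY
          (Finset.mem_of_mem_erase (Finset.mem_of_mem_erase hz)) hz
    · obtain ⟨t, htX, htU⟩ := Finset.not_disjoint_iff.1 ht
      obtain ⟨s, hs, hst⟩ := Finset.exists_mem_ne hUcard t
      refine hfinal _ _ _ (isGadget_of_isMonoClique hU (fun T => hdisj _ U T hU) htU hs hst.symm)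
        ?_ (hcard _ U hU t htU s hs hst.symm) fun K hKX hKY hK => ?_
      · rw [Finset.disjoint_left]
        intro z hz hzU
        simp only [Finset.mem_erase] at hzU
        exact hzU.2.1 (hSU z (Finset.mem_inter.2 ⟨Finset.mem_of_mem_erase hz, hzU.2.2⟩) t
          (Finset.mem_inter.2 ⟨Finset.mem_of_mem_erase htX, htU⟩))
      · obtain ⟨z, hz, hzK⟩ := Finset.not_disjoint_iff.1 (hmeet _ U K hU hK s hs)
        rw [Finset.mem_erase] at hz
        refine Finset.disjoint_left.1 hKY hzK (Finset.mem_erase.2 ⟨hz.1, Finset.mem_erase.2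
          ⟨?_, hz.2⟩⟩)
        rintro rfl
        exact Finset.disjoint_left.1 hKX hzK htX
  · exact hfinal ∅ _ c (isGadget_empty G c n _ _ c) (Finset.disjoint_empty_right _) hX₀
      fun K _ _ hK => hU ⟨K, hK⟩

end

theorem mono_Kn_same_colour_intersect_in_three (n : ℕ) (hn : 4 ≤ n)
    {α : Type*} [Fintype α] [DecidableEq α] (G : SimpleGraph α) (hG : IsRamseyFor G n)
    (c : α → α → Bool) (hc : ∀ u v, c u v = c v u)
    (hno : ¬ ∃ b S T, Disjoint S T ∧ IsMonoClique G c b n S ∧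
      IsMonoClique G c b (n - 1) T)
    (S S' : Finset α) (b : Bool)
    (hS : IsMonoClique G c b n S) (hS' : IsMonoClique G c b n S') (hne : S ≠ S') :
    3 ≤ (S ∩ S').card := by
  exact absurd (hS.eq_of_no_pair hn hG hc hno hS') hne
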